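/- Let X be a metric space. The following four conditions are equivalent: (1) every Borel probability measure μ on X satisfies μ(supp μ) = 1; (2) every Borel probability measure on X is supported on a separable subspace, i.e. some separable subset has full outer measure (equivalently, full measure when measurable); (3) for every Borel probability measure μ on X and every Borel set B ⊆ X and every ε > 0 there is a closed precompact (totally bounded) set K ⊆ B with μ(B \ K) < ε; (4) the density of X is strictly less than every real-valued measurable cardinal. -/

import Mathlib

open MeasureTheory Set Metric Cardinal TopologicalSpace
open scoped ENNReal

noncomputable section

universe u

/-- A cardinal `τ` is *real-valued measurable* if a set of cardinality `τ` carries a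
probability measure defined on *all* subsets, vanishing on singletons, whose ideal of
null sets is closed under unions of fewer than `τ` members. -/
def IsRealValuedMeasurableCardinal (τ : Cardinal.{u}) : Prop :=
  ∃ μ : @Measure τ.out ⊤,
    μ Set.univ = 1 ∧
    (∀ x : τ.out, μ {x} = 0) ∧
    ∀ 𝒩 : Set (Set τ.out), #𝒩 < τ → (∀ A ∈ 𝒩, μ A = 0) → μ (⋃₀ 𝒩) = 0

/-- The density of a topological space: the least cardinality of a dense subset. -/
def densityCard (X : Type u) [TopologicalSpace X] : Cardinal.{u} :=
  sInf {c : Cardinal.{u} | ∃ s : Set X, Dense s ∧ #s = c}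

/-- The support of a Borel measure `μ` on a metric space: the set of points all of whose
open balls have positive measure. -/
def measSupport {X : Type u} [MetricSpace X] [MeasurableSpace X] (μ : Measure X) :
    Set X :=
  {x : X | ∀ ε : ℝ, 0 < ε → 0 < μ (ball x ε)}

theorem aux_sep {X : Type u} [MetricSpace X] (s : Set X) (r : ℝ) (hr : 0 < r) :
    ∃ N ⊆ s, (∀ x ∈ N, ∀ y ∈ N, x ≠ y → r ≤ dist x y) ∧ ∀ x ∈ s, ∃ y ∈ N, dist x y < r := by
  obtain ⟨N, hN⟩ := zorn_subset
    {N : Set X | N ⊆ s ∧ ∀ x ∈ N, ∀ y ∈ N, x ≠ y → r ≤ dist x y} (by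
      intro c hc hch
      refine ⟨⋃₀ c, ⟨sUnion_subset fun t ht => (hc ht).1, ?_⟩, fun t ht => subset_sUnion_of_mem ht⟩
      rintro x ⟨t, ht, hx⟩ y ⟨t', ht', hy⟩ hxy
      rcases hch.total ht ht' with h | h
      · exact (hc ht').2 x (h hx) y hy hxy
      · exact (hc ht).2 x hx y (h hy) hxy)
  refine ⟨N, hN.prop.1, hN.prop.2, fun x hx => ?_⟩
  by_contra! hcon
  have hxN : x ∈ N := by
    have : insert x N ⊆ N := by
      refine hN.le_of_ge ⟨insert_subset hx hN.prop.1, ?_⟩ (subset_insert x N)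
      rintro a (rfl | ha) b (rfl | hb) hab
      · exact absurd rfl hab
      · exact hcon b hb
      · rw [dist_comm]; exact hcon a ha
      · exact hN.prop.2 a ha b hb hab
    exact this (mem_insert x N)
  have := hcon x hxN
  simp at this
  linarith

theorem aux_rvm {D : Type u} [MeasurableSpace D] (hD : ∀ s : Set D, MeasurableSet s)
    (ν : Measure D) [IsFiniteMeasure ν] (h0 : ν univ ≠ 0) (hs : ∀ x, ν {x} = 0) :
    ∃ τ ≤ #D, IsRealValuedMeasurableCardinal τ := by
  set P : Set Cardinal.{u} := {c | ∃ 𝒩 : Set (Set D), #𝒩 = c ∧ (∀ A ∈ 𝒩, ν A = 0) ∧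
    ν (⋃₀ 𝒩) ≠ 0} with hP
  have hDP : #D ∈ P := by
    refine ⟨range (fun x : D => ({x} : Set D)), mk_range_eq _ singleton_injective, ?_, ?_⟩
    · rintro _ ⟨x, rfl⟩; exact hs x
    · have : ⋃₀ range (fun x : D => ({x} : Set D)) = Set.univ := by
        ext x; simp
      rwa [this]
  refine ⟨sInf P, csInf_le' hDP, ?_⟩
  obtain ⟨𝒩, hcard, hnull, hpos⟩ : sInf P ∈ P := csInf_mem ⟨_, hDP⟩
  have hmin : ∀ 𝒜 : Set (Set D), #𝒜 < sInf P → (∀ A ∈ 𝒜, ν A = 0) → ν (⋃₀ 𝒜) = 0 := by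
    intro 𝒜 h1 h2
    by_contra h3
    exact absurd (csInf_le' (show #𝒜 ∈ P from ⟨𝒜, rfl, h2, h3⟩)) (not_le.2 h1)
  generalize sInf P = τ at *
  obtain ⟨e⟩ : Nonempty (𝒩 ≃ τ.out) := by
    rw [← Cardinal.eq, hcard, mk_out]
  set E := ⋃₀ 𝒩 with hE
  have hne : E.Nonempty := nonempty_of_measure_ne_zero hpos
  have hg : ∀ x : D, ∃ i : τ.out, x ∈ E → x ∈ (e.symm i : Set D) := by
    intro x
    obtain ⟨x0, t, ht, -⟩ := hne
    by_cases hx : x ∈ E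
    · obtain ⟨t, ht, hx'⟩ := hx
      exact ⟨e ⟨t, ht⟩, fun _ => by simpa using hx'⟩
    · exact ⟨e ⟨t, ht⟩, fun h => absurd h hx⟩
  choose g hg using hg
  let _ : MeasurableSpace τ.out := ⊤
  have hgm : Measurable g := fun s _ => hD _
  have key : ∀ A : Set τ.out, ((ν E)⁻¹ • (ν.restrict E).map g) A = (ν E)⁻¹ * ν (g ⁻¹' A ∩ E) := by
    intro A
    rw [Measure.smul_apply, Measure.map_apply hgm (MeasurableSpace.measurableSet_top),
      Measure.restrict_apply (hD _), smul_eq_mul]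
  have hfin : ν E ≠ ⊤ := measure_ne_top _ _
  have kz : ∀ A : Set τ.out, ((ν E)⁻¹ • (ν.restrict E).map g) A = 0 ↔ ν (g ⁻¹' A ∩ E) = 0 := by
    intro A
    rw [key, mul_eq_zero]
    simp [hfin]
  refine ⟨(ν E)⁻¹ • (ν.restrict E).map g, ?_, ?_, ?_⟩
  · rw [key, preimage_univ, univ_inter, ENNReal.inv_mul_cancel hpos hfin]
  · intro i
    rw [kz]
    refine measure_mono_null ?_ (hnull _ (e.symm i).2)
    rintro x ⟨hx, hxE⟩
    have := hg x hxE
    rwa [show g x = i from hx] at this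
  · intro 𝒜 h1 h2
    rw [kz]
    have := hmin ((fun A => g ⁻¹' A ∩ E) '' 𝒜) (mk_image_le.trans_lt h1) (by
      rintro _ ⟨A, hA, rfl⟩
      exact (kz A).1 (h2 A hA))
    refine measure_mono_null ?_ this
    rintro x ⟨⟨A, hA, hx⟩, hxE⟩
    exact ⟨_, ⟨A, hA, rfl⟩, hx, hxE⟩

theorem aux_14 (X : Type u) [MetricSpace X] [MeasurableSpace X] [BorelSpace X]
    (h : ∀ μ : Measure X, IsProbabilityMeasure μ → μ (measSupport μ) = 1)
    (τ : Cardinal.{u}) (hτ : IsRealValuedMeasurableCardinal τ) : densityCard X < τ := by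
  by_contra! hle
  obtain ⟨ν, hν1, hν0, -⟩ := hτ
  let _ : MeasurableSpace τ.out := ⊤
  have hpos : ∀ n : ℕ, (0 : ℝ) < 1 / ((n : ℝ) + 1) := fun n => Nat.one_div_pos_of_nat
  choose A _ hA1 hA2 using fun n : ℕ => aux_sep (univ : Set X) (1 / ((n : ℝ) + 1)) (hpos n)
  have hdense : Dense (⋃ n, A n) := by
    rw [Metric.dense_iff]
    intro x r hr
    obtain ⟨n, hn⟩ := exists_nat_one_div_lt hr
    obtain ⟨y, hy, hxy⟩ := hA2 n x trivial
    exact ⟨y, by rw [mem_ball']; exact hxy.trans hn, mem_iUnion.2 ⟨n, hy⟩⟩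
  have hle2 : #τ.out ≤ #(⋃ n, A n : Set X) := by
    rw [mk_out]
    exact hle.trans (csInf_le' ⟨_, hdense, rfl⟩)
  obtain ⟨f⟩ := hle2
  set F : τ.out → X := fun i => (f i : X) with hF
  have hFinj : Function.Injective F := Subtype.val_injective.comp f.injective
  have hFm : Measurable F := fun s _ => MeasurableSpace.measurableSet_top
  obtain ⟨n, hn⟩ : ∃ n, ν (F ⁻¹' A n) ≠ 0 := by
    by_contra! hcon
    have : ν (⋃ n, F ⁻¹' A n) = 0 := measure_iUnion_null hcon
    rw [← preimage_iUnion, show F ⁻¹' (⋃ n, A n) = Set.univ from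
      eq_univ_of_forall fun i => (f i).2, hν1] at this
    exact one_ne_zero this
  have : IsProbabilityMeasure ν := ⟨hν1⟩
  set E := F ⁻¹' A n with hE
  have hfin : ν E ≠ ⊤ := measure_ne_top _ _
  set μ : Measure X := (ν E)⁻¹ • (ν.restrict E).map F with hμ
  have key : ∀ B : Set X, MeasurableSet B → μ B = (ν E)⁻¹ * ν (F ⁻¹' B ∩ E) := by
    intro B hB
    rw [hμ, Measure.smul_apply, Measure.map_apply hFm hB,
      Measure.restrict_apply (MeasurableSpace.measurableSet_top), smul_eq_mul]
  have hprob : IsProbabilityMeasure μ := ⟨by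
    rw [key _ MeasurableSet.univ, preimage_univ, univ_inter, ENNReal.inv_mul_cancel hn hfin]⟩
  have hsupp : measSupport μ = ∅ := by
    refine eq_empty_of_forall_notMem fun x hx => ?_
    have h1 := hx (1 / ((n : ℝ) + 1) / 2) (half_pos (hpos n))
    rw [key _ measurableSet_ball] at h1
    have h2 : (F ⁻¹' ball x (1 / ((n : ℝ) + 1) / 2) ∩ E).Subsingleton := by
      rintro i ⟨hi, hiE⟩ j ⟨hj, hjE⟩
      by_contra hij
      have h3 := hA1 n (F i) hiE (F j) hjE (fun hh => hij (hFinj hh))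
      have h4 := dist_triangle_right (F i) (F j) x
      rw [mem_preimage, mem_ball] at hi hj
      linarith
    have h5 : ν (F ⁻¹' ball x (1 / ((n : ℝ) + 1) / 2) ∩ E) = 0 := by
      rcases h2.eq_empty_or_singleton with h | ⟨i, h⟩
      · rw [h, measure_empty]
      · rw [h, hν0]
    rw [h5] at h1
    simp at h1
  have := h μ hprob
  rw [hsupp, measure_empty] at this
  exact zero_ne_one this

theorem aux_12 (X : Type u) [MetricSpace X] [MeasurableSpace X] [BorelSpace X]
    (μ : Measure X) [IsProbabilityMeasure μ] : IsSeparable (measSupport μ) := by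
  have : ∀ ε > 0, ∃ t : Set X, t.Countable ∧ measSupport μ ⊆ ⋃ x ∈ t, closedEBall x ε := by
    intro ε hε
    obtain ⟨r, hr, hrε⟩ : ∃ r : ℝ, 0 < r ∧ ENNReal.ofReal r ≤ ε := by
      obtain ⟨q, hq, hq'⟩ := ENNReal.lt_iff_exists_nnreal_btwn.1 hε
      exact ⟨q, by exact_mod_cast hq, by simpa using hq'.le⟩
    obtain ⟨N, hNs, hN1, hN2⟩ := aux_sep (measSupport μ) r hr
    refine ⟨N, ?_, ?_⟩
    · have := Measure.countable_meas_pos_of_disjoint_iUnion (μ := μ)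
        (As := fun x : N => ball (x : X) (r / 2)) (fun _ => measurableSet_ball) (by
          intro x y hxy
          apply ball_disjoint_ball
          have := hN1 x x.2 y y.2 (fun h => hxy (Subtype.ext h))
          linarith)
      rw [show {i : N | 0 < μ (ball (i : X) (r / 2))} = Set.univ from
        eq_univ_of_forall fun i => hNs i.2 _ (half_pos hr)] at this
      exact countable_coe_iff.1 (countable_univ_iff.1 this)
    · intro x hx
      obtain ⟨y, hy, hxy⟩ := hN2 x hx
      refine mem_biUnion hy ?_
      rw [mem_closedEBall, edist_dist]
      exact (ENNReal.ofReal_le_ofReal hxy.le).trans hrε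
  obtain ⟨t, -, htc, ht⟩ := EMetric.subset_countable_closure_of_almost_dense_set _ this
  exact ⟨t, htc, ht⟩

theorem aux_21 (X : Type u) [MetricSpace X] [MeasurableSpace X] [BorelSpace X]
    (μ : Measure X) [IsProbabilityMeasure μ] (S : Set X) (hS : IsSeparable S) (h1 : μ S = 1) :
    μ (measSupport μ) = 1 := by
  refine le_antisymm prob_le_one ?_
  have h0 : μ (S \ measSupport μ) = 0 := by
    have hsep : IsSeparable (S \ measSupport μ) := hS.mono sdiff_subset
    have : SeparableSpace (S \ measSupport μ : Set X) := hsep.separableSpace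
    have : SecondCountableTopology (S \ measSupport μ : Set X) :=
      UniformSpace.secondCountable_of_separable _
    have hL : IsLindelof (S \ measSupport μ) := by
      rw [isLindelof_iff_isLindelof_univ]
      exact isLindelof_univ
    have hr : ∀ x : X, x ∉ measSupport μ → ∃ r, 0 < r ∧ μ (ball x r) = 0 := by
      intro x hx
      simpa [measSupport] using hx
    have h2 : (S \ measSupport μ)ᶜ ∈ ae μ := by
      refine hL.compl_mem_sets_of_nhdsWithin fun x hx => ?_
      obtain ⟨r, hr0, hr1⟩ := hr x hx.2
      refine ⟨ball x r, mem_nhdsWithin_of_mem_nhds (ball_mem_nhds x hr0), ?_⟩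
      rwa [compl_mem_ae_iff]
    rwa [compl_mem_ae_iff] at h2
  calc (1 : ℝ≥0∞) = μ S := h1.symm
    _ ≤ μ (measSupport μ ∪ (S \ measSupport μ)) := measure_mono (by intro x hx; by_cases h : x ∈ measSupport μ <;> simp [h, hx])
    _ ≤ μ (measSupport μ) + 0 := by rw [← h0]; exact measure_union_le _ _
    _ = _ := add_zero _

theorem aux_23 (X : Type u) [MetricSpace X] [MeasurableSpace X] [BorelSpace X]
    (μ : Measure X) [IsProbabilityMeasure μ] (S : Set X) (hS : IsSeparable S) (h1 : μ S = 1)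
    (B : Set X) (hB : MeasurableSet B) (ε : ℝ≥0∞) (hε : 0 < ε) :
    ∃ K, K ⊆ B ∧ IsClosed K ∧ TotallyBounded K ∧ μ (B \ K) < ε := by
  obtain ⟨c, hc, hSc⟩ := hS
  have hcne : c.Nonempty := by
    by_contra h
    rw [not_nonempty_iff_eq_empty] at h
    rw [h, closure_empty, subset_empty_iff] at hSc
    rw [hSc, measure_empty] at h1
    exact zero_ne_one h1
  obtain ⟨f, rfl⟩ := hc.exists_eq_range hcne
  have hpos : ∀ n : ℕ, (0 : ℝ) < 1 / ((n : ℝ) + 1) := fun n => Nat.one_div_pos_of_nat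
  have hε2 : ε / 2 ≠ 0 := (ENNReal.half_pos hε.ne').ne'
  obtain ⟨δ, hδ, hsum⟩ := ENNReal.exists_pos_sum_of_countable' hε2 ℕ
  set T : ℕ → ℕ → Set X := fun n N => ⋃ i ∈ Finset.range N, closedBall (f i) (1 / ((n : ℝ) + 1))
    with hT
  have hTc : ∀ n N, IsClosed (T n N) := fun n N =>
    isClosed_biUnion_finset fun i _ => isClosed_closedBall
  have hN : ∀ n, ∃ N, μ (T n N)ᶜ < δ n := by
    intro n
    have hanti : Antitone fun N => (T n N)ᶜ := by
      intro a b hab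
      refine compl_subset_compl.2 (biUnion_subset_biUnion_left ?_)
      intro i hi
      simp at hi ⊢
      omega
    have h := tendsto_measure_iInter_atTop (μ := μ)
      (fun N => (hTc n N).isOpen_compl.measurableSet.nullMeasurableSet) hanti
      ⟨0, measure_ne_top _ _⟩
    have h0 : μ (⋂ N, (T n N)ᶜ) = 0 := by
      rw [← compl_iUnion, prob_compl_eq_zero_iff (MeasurableSet.iUnion fun N => (hTc n N).measurableSet)]
      refine le_antisymm prob_le_one ?_
      rw [← h1]
      refine measure_mono fun x hx => ?_
      obtain ⟨_, ⟨i, rfl⟩, hi⟩ := Metric.mem_closure_iff.1 (hSc hx) _ (hpos n)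
      refine mem_iUnion.2 ⟨i + 1, mem_biUnion (x := i) (by simp) ?_⟩
      exact hi.le
    rw [h0] at h
    exact ((tendsto_order.1 h).2 _ (hδ n)).exists
  choose N hN using hN
  obtain ⟨C, hCB, hCc, hC⟩ := hB.exists_isClosed_sdiff_lt (μ := μ) (measure_ne_top _ _) hε2
  refine ⟨C ∩ ⋂ n, T n (N n), inter_subset_left.trans hCB,
    hCc.inter (isClosed_iInter fun n => hTc _ _), ?_, ?_⟩
  · rw [Metric.totallyBounded_iff]
    intro r hr
    obtain ⟨n, hn⟩ := exists_nat_one_div_lt hr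
    refine ⟨f '' (Finset.range (N n) : Set ℕ), (Finset.finite_toSet _).image _, ?_⟩
    rintro x ⟨-, hx⟩
    have := mem_iInter.1 hx n
    simp only [hT, mem_iUnion] at this
    obtain ⟨i, hi, hx⟩ := this
    refine mem_biUnion (mem_image_of_mem f hi) ?_
    exact lt_of_le_of_lt hx hn
  · calc μ (B \ (C ∩ ⋂ n, T n (N n))) ≤ μ ((B \ C) ∪ ⋃ n, (T n (N n))ᶜ) := by
          refine measure_mono ?_
          rintro x ⟨hx, hx'⟩
          by_cases hxC : x ∈ C
          · right
            rw [← compl_iInter]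
            exact fun h => hx' ⟨hxC, h⟩
          · exact Or.inl ⟨hx, hxC⟩
      _ ≤ μ (B \ C) + ∑' n, μ (T n (N n))ᶜ :=
          (measure_union_le _ _).trans (by gcongr; exact measure_iUnion_le _)
      _ ≤ μ (B \ C) + ∑' n, δ n := by
          gcongr with n
          exact (hN n).le
      _ < ε / 2 + ε / 2 := ENNReal.add_lt_add hC hsum
      _ = ε := ENNReal.add_halves ε

theorem aux_32 (X : Type u) [MetricSpace X] [MeasurableSpace X] [BorelSpace X]
    (μ : Measure X) [IsProbabilityMeasure μ]
    (h : ∀ ε : ℝ≥0∞, 0 < ε →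
           ∃ K : Set X, IsClosed K ∧ TotallyBounded K ∧ μ (univ \ K) < ε) :
    ∃ S : Set X, IsSeparable S ∧ μ S = 1 := by
  choose K hKc hKt hK using fun n : ℕ => h ((n : ℝ≥0∞) + 1)⁻¹ (by simp)
  refine ⟨⋃ n, K n, IsSeparable.iUnion fun n => (hKt n).isSeparable, ?_⟩
  rw [← prob_compl_eq_zero_iff (MeasurableSet.iUnion fun n => (hKc n).measurableSet)]
  by_contra h0
  obtain ⟨n, hn⟩ := ENNReal.exists_inv_nat_lt h0
  refine absurd (hn.trans_le (measure_mono (t := univ \ K n) ?_)) (not_lt.2 ((hK n).le.trans ?_))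
  · rw [compl_iUnion, ← compl_eq_univ_sdiff]
    exact iInter_subset _ n
  · exact ENNReal.inv_le_inv.2 le_self_add

theorem aux_41 (X : Type u) [MetricSpace X] [MeasurableSpace X] [BorelSpace X]
    (μ : Measure X) [IsProbabilityMeasure μ] 
    (h : ∀ τ : Cardinal.{u}, IsRealValuedMeasurableCardinal τ → densityCard X < τ) :
    μ (measSupport μ) = 1 := by
  have hXne : Nonempty X := nonempty_of_isProbabilityMeasure μ
  by_contra hsupp
  obtain ⟨D, hDd, hDc⟩ : densityCard X ∈ {c : Cardinal.{u} | ∃ s : Set X, Dense s ∧ #s = c} :=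
    csInf_mem ⟨_, univ, dense_univ, rfl⟩
  have hr : ∀ x : X, ∃ r, x ∉ measSupport μ → 0 < r ∧ μ (ball x r) = 0 := by
    intro x
    by_cases hx : x ∈ measSupport μ
    · exact ⟨0, fun h => absurd hx h⟩
    · have : ∃ r, 0 < r ∧ μ (ball x r) = 0 := by simpa [measSupport] using hx
      obtain ⟨r, h⟩ := this
      exact ⟨r, fun _ => h⟩
  choose r hr using hr
  -- `b x` is a null open set, covering off the support
  obtain ⟨b, hbo, hb0, hbs⟩ : ∃ b : X → Set X, (∀ x, IsOpen (b x)) ∧ (∀ x, μ (b x) = 0) ∧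
      ∀ x ∉ measSupport μ, x ∈ b x := by
    classical
    refine ⟨fun x => if x ∈ measSupport μ then ∅ else ball x (r x), fun x => ?_, fun x => ?_,
      fun x hx => ?_⟩
    · dsimp only; split_ifs
      exacts [isOpen_empty, isOpen_ball]
    · dsimp only; split_ifs with hx
      exacts [measure_empty, (hr x hx).2]
    · simp [hx, (hr x hx).1]
  have hpos : ∀ n : ℕ, (0 : ℝ) < 1 / ((n : ℝ) + 1) := fun n => Nat.one_div_pos_of_nat
  obtain ⟨hlin, hwf⟩ := exists_wellFoundedLT X
  set W : ℕ → X → Set X := fun n a => {x | (∀ y ∉ b a, 1 / ((n : ℝ) + 1) ≤ dist x y) ∧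
    ∀ a' < a, x ∉ b a'} with hW
  set V : ℕ → X → Set X := fun n a => thickening (1 / ((n : ℝ) + 1) / 3) (W n a) with hV
  have hVo : ∀ n a, IsOpen (V n a) := fun n a => isOpen_thickening
  have hVb : ∀ n a, V n a ⊆ b a := by
    intro n a x hx
    obtain ⟨z, hz, hxz⟩ := mem_thickening_iff.1 hx
    by_contra hxb
    have := hz.1 x hxb
    rw [dist_comm] at this
    have := hpos n
    linarith
  have hVdlt : ∀ n a a', a' < a → ∀ x, x ∈ V n a → x ∈ V n a' → False := by
    intro n a a' haa x hx hx'
    obtain ⟨z, hz, hxz⟩ := mem_thickening_iff.1 hx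
    obtain ⟨z', hz', hxz'⟩ := mem_thickening_iff.1 hx'
    have h1 := hz'.1 z (hz.2 a' haa)
    have h2 := dist_triangle_left z' z x
    have := hpos n
    linarith
  have hVd : ∀ n a a' x, x ∈ V n a → x ∈ V n a' → a = a' := by
    intro n a a' x hx hx'
    rcases lt_trichotomy a a' with h | h | h
    · exact (hVdlt n a' a h x hx' hx).elim
    · exact h
    · exact (hVdlt n a a' h x hx hx').elim
  have hcov : (measSupport μ)ᶜ ⊆ ⋃ n, ⋃ a, V n a := by
    intro x hx
    have hne : {a | x ∈ b a}.Nonempty := ⟨x, hbs x hx⟩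
    obtain ⟨a, ha, hamin⟩ := hwf.wf.has_min _ hne
    obtain ⟨s, hs, hsb⟩ := Metric.isOpen_iff.1 (hbo a) x ha
    obtain ⟨n, hn⟩ := exists_nat_one_div_lt hs
    refine mem_iUnion.2 ⟨n, mem_iUnion.2 ⟨a, self_subset_thickening (by have := hpos n; linarith) _ ⟨?_, ?_⟩⟩⟩
    · intro y hy
      by_contra! hlt
      exact hy (hsb (by rw [mem_ball']; exact hlt.trans hn))
    · intro a' ha' hxa'
      exact hamin a' hxa' ha'
  obtain ⟨n, hn⟩ : ∃ n, μ (⋃ a, V n a) ≠ 0 := by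
    by_contra! hcon
    have h0 : μ (measSupport μ)ᶜ = 0 := measure_mono_null hcov (measure_iUnion_null hcon)
    apply hsupp
    refine le_antisymm prob_le_one ?_
    calc (1 : ℝ≥0∞) = μ (measSupport μ ∪ (measSupport μ)ᶜ) := by rw [union_compl_self, measure_univ]
      _ ≤ μ (measSupport μ) + 0 := by rw [← h0]; exact measure_union_le _ _
      _ = _ := add_zero _
  set C := ⋃ a, V n a with hC
  have hCo : IsOpen C := isOpen_iUnion fun a => hVo n a
  have hd : ∀ a, ∃ d : D, (V n a).Nonempty → (d : X) ∈ V n a := by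
    intro a
    by_cases hne : (V n a).Nonempty
    · obtain ⟨d, hd, hdD⟩ := hDd.inter_open_nonempty _ (hVo n a) hne
      exact ⟨⟨d, hdD⟩, fun _ => hd⟩
    · obtain ⟨d, hdD⟩ := hDd.nonempty
      exact ⟨⟨d, hdD⟩, fun h => absurd h hne⟩
  choose d hd using hd
  obtain ⟨x0⟩ := hXne
  have ha : ∀ x, ∃ a, (x ∈ C → x ∈ V n a) ∧ (x ∉ C → a = x0) := by
    intro x
    by_cases hx : x ∈ C
    · obtain ⟨a, ha⟩ := mem_iUnion.1 hx
      exact ⟨a, fun _ => ha, fun h => absurd hx h⟩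
    · exact ⟨x0, fun h => absurd h hx, fun _ => rfl⟩
  choose a haC haC' using ha
  let _ : MeasurableSpace D := ⊤
  have hm : Measurable fun x => d (a x) := by
    intro A _
    have : (fun x => d (a x)) ⁻¹' A = (⋃ a ∈ {a | d a ∈ A}, V n a) ∪ (Cᶜ ∩ {x | d x0 ∈ A}) := by
      ext x
      simp only [mem_preimage, mem_union, mem_iUnion, mem_inter_iff, mem_compl_iff, mem_ofPred_eq,
        exists_prop]
      constructor
      · intro hx
        by_cases hxC : x ∈ C
        · exact Or.inl ⟨a x, hx, haC x hxC⟩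
        · right
          rw [haC' x hxC] at hx
          exact ⟨hxC, hx⟩
      · rintro (⟨α, hα, hxα⟩ | ⟨hxC, hx⟩)
        · rwa [← hVd n α (a x) x hxα (haC x (mem_iUnion.2 ⟨α, hxα⟩))]
        · rwa [haC' x hxC]
    rw [this]
    exact ((isOpen_biUnion fun a _ => hVo n a).measurableSet).union
      (hCo.measurableSet.compl.inter (MeasurableSet.const _))
  obtain ⟨τ, hτ, hτr⟩ := aux_rvm (D := D) (fun s => MeasurableSpace.measurableSet_top)
    ((μ.restrict C).map fun x => d (a x)) (by
      rw [Measure.map_apply hm MeasurableSet.univ, preimage_univ, Measure.restrict_apply_univ]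
      exact hn) (by
      intro e
      rw [Measure.map_apply hm MeasurableSpace.measurableSet_top,
        Measure.restrict_apply (hm MeasurableSpace.measurableSet_top)]
      rcases eq_empty_or_nonempty ((fun x => d (a x)) ⁻¹' {e} ∩ C) with h | ⟨y, hy, hyC⟩
      · rw [h, measure_empty]
      · refine measure_mono_null ?_ (hb0 (a y))
        rintro x ⟨hx, hxC⟩
        have h1 := hd (a x) ⟨x, haC x hxC⟩
        have h2 := hd (a y) ⟨y, haC y hyC⟩
        rw [show d (a x) = e from hx] at h1
        rw [show d (a y) = e from hy] at h2
        rw [hVd n _ _ _ h2 h1]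
        exact hVb n _ (haC x hxC))
  rw [hDc] at hτ
  exact absurd (h τ hτr) (not_lt.2 hτ)

/-- **Theorem.** For a metric space `X` (with its Borel sigma-algebra), the following
are equivalent:
1. every Borel probability measure on `X` gives full measure to its support;
2. every Borel probability measure on `X` is supported on a separable subspace (a
   separable subset of full outer measure);
3. every Borel probability measure on `X` is regular: every Borel set contains, up to
   measure `ε`, a closed totally bounded subset;
4. the density of `X` is strictly less than every real-valued measurable cardinal. -/
theorem metric_space_measure_tfae
    (X : Type u) [MetricSpace X] [MeasurableSpace X] [BorelSpace X] :
    List.TFAE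
      [∀ μ : Measure X, IsProbabilityMeasure μ → μ (measSupport μ) = 1,
       ∀ μ : Measure X, IsProbabilityMeasure μ →
         ∃ S : Set X, IsSeparable S ∧ μ S = 1,
       ∀ μ : Measure X, IsProbabilityMeasure μ →
         ∀ B : Set X, MeasurableSet B → ∀ ε : ℝ≥0∞, 0 < ε →
           ∃ K, K ⊆ B ∧ IsClosed K ∧ TotallyBounded K ∧ μ (B \ K) < ε,
       ∀ τ : Cardinal.{u}, IsRealValuedMeasurableCardinal τ → densityCard X < τ] := by
  tfae_have 1 → 2 := fun h μ hμ => ⟨_, aux_12 X μ, h μ hμ⟩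
  tfae_have 2 → 1 := fun h μ hμ => by
    obtain ⟨S, hS, h1⟩ := h μ hμ
    exact aux_21 X μ S hS h1
  tfae_have 2 → 3 := fun h μ hμ B hB ε hε => by
    obtain ⟨S, hS, h1⟩ := h μ hμ
    exact aux_23 X μ S hS h1 B hB ε hε
  tfae_have 3 → 2 := fun h μ hμ => aux_32 X μ fun ε hε => by
    obtain ⟨K, -, hK⟩ := h μ hμ univ MeasurableSet.univ ε hε
    exact ⟨K, hK⟩
  tfae_have 1 → 4 := fun h τ hτ => aux_14 X h τ hτ
  tfae_have 4 → 1 := fun h μ hμ => aux_41 X μ h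
  tfae_finish

end
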